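/- Let F ∈ L²(Ω), let ψ ∈ L²(Ω), g ∈ L²(Ω)^d, ζ ∈ 𝕊 be exact data, and let C_P ≥ 0. For each m ∈ ℕ let D_m = (X_m, Π_m, G_m, H_m) be a Hessian discretisation with coercivity constant C_P, let ψ_m ∈ X_m solve the Hessian scheme for F associated with D_m, let W_m ≥ 0 satisfy |⟨F, Π_m w⟩ − ⟨ζ, H_m w⟩| ≤ W_m ‖H_m w‖ for all w ∈ X_m, and let S_m ≥ 0 and v_m ∈ X_m satisfy ‖Π_m v_m − ψ‖ + ‖G_m v_m − g‖ + ‖H_m v_m − ζ‖ ≤ S_m. If W_m → 0 and S_m → 0 as m → ∞, then Π_m ψ_m → ψ in L²(Ω), G_m ψ_m → g in L²(Ω)^d, and H_m ψ_m → ζ in 𝕊. -/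

import Mathlib

open MeasureTheory Filter
open scoped RealInnerProductSpace Topology

/-- If the inner product of `u` with `a - b` is within `W * ‖a - b‖` of that of `a` with `a - b`,
then `a - b` is controlled by `W` and the distance from `b` to `u`. -/
theorem norm_sub_le_of_abs_inner_sub_le {E : Type*} [NormedAddCommGroup E]
    [InnerProductSpace ℝ E] {a b u : E} {W : ℝ} (hW : 0 ≤ W)
    (h : |⟪a, a - b⟫ - ⟪u, a - b⟫| ≤ W * ‖a - b‖) : ‖a - b‖ ≤ W + ‖b - u‖ := by
  have hsq : ‖a - b‖ * ‖a - b‖ ≤ (W + ‖b - u‖) * ‖a - b‖ := by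
    have hexp : ⟪a - b, a - b⟫ = (⟪a, a - b⟫ - ⟪u, a - b⟫) - ⟪b - u, a - b⟫ := by
      rw [inner_sub_left a b, inner_sub_left b u]
      ring
    have hcs := (abs_le.mp (abs_real_inner_le_norm (b - u) (a - b))).1
    have hle := (abs_le.mp h).2
    rw [← real_inner_self_eq_norm_mul_norm, hexp]
    linarith
  rcases (norm_nonneg (a - b)).eq_or_lt with h0 | hpos
  · rw [← h0]
    positivity
  · exact le_of_mul_le_mul_right hsq hpos

/-- Convergence from a vanishing bound on the distance to a consistent approximation. -/
theorem tendsto_of_norm_sub_le_of_norm_sub_le {E : Type*} [SeminormedAddCommGroup E]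
    {x y : ℕ → E} {l : E} {A B : ℕ → ℝ} (hxy : ∀ m, ‖x m - y m‖ ≤ A m)
    (hyl : ∀ m, ‖y m - l‖ ≤ B m) (hA : Tendsto A atTop (𝓝 0)) (hB : Tendsto B atTop (𝓝 0)) :
    Tendsto x atTop (𝓝 l) := by
  rw [tendsto_iff_norm_sub_tendsto_zero]
  refine squeeze_zero (fun _ => norm_nonneg _)
    (fun m => (norm_sub_le_norm_sub_add_norm_sub (x m) (y m) l).trans
      (add_le_add (hxy m) (hyl m))) ?_
  simpa using hA.add hB

/-- **Convergence of Hessian schemes.**  For a coercive sequence of Hessian discretisations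
whose limit-conformity defects `W_m` and consistency errors `S_m` tend to `0`, the
reconstructed functions, gradients and Hessians of the discrete solutions converge in `L²`
to the exact data `ψ`, `g`, `ζ`. -/
theorem hessian_scheme_convergence
    {Ω : Type*} [MeasurableSpace Ω] (μ : Measure Ω) (d : ℕ) (hd : 1 ≤ d)
    (F ψ : Lp ℝ 2 μ) (g : Lp (EuclideanSpace ℝ (Fin d)) 2 μ)
    (ζ : Lp (EuclideanSpace ℝ (Fin d × Fin d)) 2 μ)
    (C_P : ℝ) (hCP : 0 ≤ C_P)
    (X : ℕ → Type*) [∀ m, AddCommGroup (X m)] [∀ m, Module ℝ (X m)]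
    (Pd : ∀ m, X m →ₗ[ℝ] Lp ℝ 2 μ)
    (Gd : ∀ m, X m →ₗ[ℝ] Lp (EuclideanSpace ℝ (Fin d)) 2 μ)
    (Hd : ∀ m, X m →ₗ[ℝ] Lp (EuclideanSpace ℝ (Fin d × Fin d)) 2 μ)
    (hcoerPi : ∀ m, ∀ w : X m, ‖Pd m w‖ ≤ C_P * ‖Hd m w‖)
    (hcoerG : ∀ m, ∀ w : X m, ‖Gd m w‖ ≤ C_P * ‖Hd m w‖)
    (ψD : ∀ m, X m)
    (hψD : ∀ m, ∀ w : X m, ⟪Hd m (ψD m), Hd m w⟫ = ⟪F, Pd m w⟫)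
    (W : ℕ → ℝ) (hW : ∀ m, 0 ≤ W m)
    (hlc : ∀ m, ∀ w : X m, |⟪F, Pd m w⟫ - ⟪ζ, Hd m w⟫| ≤ W m * ‖Hd m w‖)
    (S : ℕ → ℝ) (hS : ∀ m, 0 ≤ S m) (v : ∀ m, X m)
    (hcons : ∀ m, ‖Pd m (v m) - ψ‖ + ‖Gd m (v m) - g‖ + ‖Hd m (v m) - ζ‖ ≤ S m)
    (hWlim : Tendsto W atTop (𝓝 0)) (hSlim : Tendsto S atTop (𝓝 0)) :
    Tendsto (fun m => Pd m (ψD m)) atTop (𝓝 ψ) ∧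
      Tendsto (fun m => Gd m (ψD m)) atTop (𝓝 g) ∧
      Tendsto (fun m => Hd m (ψD m)) atTop (𝓝 ζ) := by
  have hP : ∀ m, ‖Pd m (v m) - ψ‖ ≤ S m := fun m => by
    linarith [hcons m, norm_nonneg (Gd m (v m) - g), norm_nonneg (Hd m (v m) - ζ)]
  have hG : ∀ m, ‖Gd m (v m) - g‖ ≤ S m := fun m => by
    linarith [hcons m, norm_nonneg (Pd m (v m) - ψ), norm_nonneg (Hd m (v m) - ζ)]
  have hH : ∀ m, ‖Hd m (v m) - ζ‖ ≤ S m := fun m => by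
    linarith [hcons m, norm_nonneg (Pd m (v m) - ψ), norm_nonneg (Gd m (v m) - g)]
  have herr : ∀ m, ‖Hd m (ψD m) - Hd m (v m)‖ ≤ W m + S m := fun m => by
    have h := hlc m (ψD m - v m)
    rw [← hψD, map_sub] at h
    exact (norm_sub_le_of_abs_inner_sub_le (hW m) h).trans (by linarith [hH m])
  have hlim : Tendsto (fun m => W m + S m) atTop (𝓝 0) := by
    simpa using hWlim.add hSlim
  have hClim : Tendsto (fun m => C_P * (W m + S m)) atTop (𝓝 0) := by
    simpa using hlim.const_mul C_P
  refine ⟨tendsto_of_norm_sub_le_of_norm_sub_le (fun m => ?_) hP hClim hSlim,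
    tendsto_of_norm_sub_le_of_norm_sub_le (fun m => ?_) hG hClim hSlim,
    tendsto_of_norm_sub_le_of_norm_sub_le herr hH hlim hSlim⟩
  · rw [← map_sub]
    refine (hcoerPi m _).trans (mul_le_mul_of_nonneg_left ?_ hCP)
    simpa only [map_sub] using herr m
  · rw [← map_sub]
    refine (hcoerG m _).trans (mul_le_mul_of_nonneg_left ?_ hCP)
    simpa only [map_sub] using herr m
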